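/- arXiv:2406.05609 — 2 statements merged into one kernel-verified Lean document; each statement's English description precedes it below -/
import Mathlib

section
/- In the Setup, no vertex of B is adjacent to all vertices of A; that is, every w ∈ B has at least one non-neighbor in A. -/
open Matrix

/-- The spectral radius of a finite simple graph: the largest eigenvalue of its
adjacency matrix (as a real symmetric matrix), expressed as the supremum of the
set of eigenvalues of the associated linear endomorphism. -/
noncomputable def specRad {V : Type*} [Fintype V] (G : SimpleGraph V) : ℝ :=
  letI := Classical.decEq V
  letI := Classical.decRel G.Adj
  sSup {μ : ℝ | Module.End.HasEigenvalue (Matrix.toLin' (SimpleGraph.adjMatrix ℝ G)) μ}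

/-- The number of triangles (3-cliques) of a finite simple graph. -/
noncomputable def triangleCount {V : Type*} [Fintype V] (G : SimpleGraph V) : ℕ :=
  letI := Classical.decEq V
  letI := Classical.decRel G.Adj
  (G.cliqueFinset 3).card

/-- The graph on `Fin n` obtained from the complete bipartite graph with parts
`{0, …, a-1}` and `{a, …, n-1}` by adding the extra edge `{0, 1}` inside the
first part. -/
def KbipPlus (n a : ℕ) : SimpleGraph (Fin n) :=
  SimpleGraph.fromRel (fun u v => ((u : ℕ) < a ∧ a ≤ (v : ℕ)) ∨ ((u : ℕ) = 0 ∧ (v : ℕ) = 1))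

/-- `K⁺_{⌈n/2⌉,⌊n/2⌋}`: the complete bipartite graph with parts of sizes `⌈n/2⌉`
and `⌊n/2⌋` together with one extra edge inside the part of size `⌈n/2⌉`
(added between vertices `0` and `1`). -/
def Kplus (n : ℕ) : SimpleGraph (Fin n) := KbipPlus n ((n + 1) / 2)

/-- `K^{+|}`: the graph on `Fin n` obtained from the complete bipartite graph with
parts `{0, …, a-1}` and `{a, …, n-1}` by adding the edge `e₁ = {0, 1}` inside the
first part and deleting the cross edge `e₂ = {0, a}`, which shares the endpoint `0`
with `e₁`. -/
def KbipPlusMinus (n a : ℕ) : SimpleGraph (Fin n) :=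
  SimpleGraph.fromRel (fun u v =>
    (((u : ℕ) < a ∧ a ≤ (v : ℕ)) ∧ ¬((u : ℕ) = 0 ∧ (v : ℕ) = a)) ∨
      ((u : ℕ) = 0 ∧ (v : ℕ) = 1))

lemma dotProduct_adjMatrix_mulVec_le_specRad {V : Type*} [Fintype V] [DecidableEq V]
    (H : SimpleGraph V) [DecidableRel H.Adj] (y : V → ℝ) :
    y ⬝ᵥ (H.adjMatrix ℝ *ᵥ y) ≤ specRad H * (y ⬝ᵥ y) := by
  set s := specRad H with hs
  have hle : ∀ μ, Module.End.HasEigenvalue (Matrix.toLin' (H.adjMatrix ℝ)) μ → μ ≤ s := by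
    intro μ hμ
    rw [hs, specRad]
    refine le_csSup (Set.Finite.bddAbove (Module.End.finite_hasEigenvalue _)) ?_
    simp only [Set.mem_ofPred_eq]
    convert hμ
  have hherm : (s • (1 : Matrix V V ℝ) - H.adjMatrix ℝ).IsHermitian := by
    simp [Matrix.IsHermitian, Matrix.conjTranspose_eq_transpose_of_trivial]
  have hpsd : (s • (1 : Matrix V V ℝ) - H.adjMatrix ℝ).PosSemidef := by
    rw [hherm.posSemidef_iff_eigenvalues_nonneg]
    intro i
    have hv := hherm.mulVec_eigenvectorBasis i
    have h0 : (hherm.eigenvectorBasis i : V → ℝ) ≠ 0 := by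
      intro h
      exact hherm.eigenvectorBasis.toBasis.ne_zero i (by ext j; simpa using congrFun h j)
    have := hle (s - hherm.eigenvalues i) <| Module.End.hasEigenvalue_of_hasEigenvector
      (x := (hherm.eigenvectorBasis i : V → ℝ))
      ⟨Module.End.mem_eigenspace_iff.2 (by
        rw [Matrix.sub_mulVec, Matrix.smul_mulVec, Matrix.one_mulVec] at hv
        rw [Matrix.toLin'_apply, sub_smul, ← hv]; abel), h0⟩
    simp only [Pi.zero_apply]
    linarith
  have := hpsd.dotProduct_mulVec_nonneg y
  simp only [star_trivial, Matrix.sub_mulVec, Matrix.smul_mulVec, Matrix.one_mulVec,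
    dotProduct_sub, dotProduct_smul, smul_eq_mul] at this
  linarith

lemma lt_specRad_of_smul_lt_adjMatrix_mulVec {V : Type*} [Fintype V] [DecidableEq V]
    (H : SimpleGraph V) [DecidableRel H.Adj] {μ : ℝ} {y : V → ℝ} (hy : ∀ i, 0 < y i)
    (h : μ • y < H.adjMatrix ℝ *ᵥ y) : μ < specRad H := by
  obtain ⟨hle, i, hi⟩ := Pi.lt_def.1 h
  have h1 : y ⬝ᵥ (μ • y) < y ⬝ᵥ (H.adjMatrix ℝ *ᵥ y) :=
    Finset.sum_lt_sum (fun j _ => mul_le_mul_of_nonneg_left (hle j) (hy j).le)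
      ⟨i, Finset.mem_univ i, mul_lt_mul_of_pos_left hi (hy i)⟩
  have h2 := h1.trans_le (dotProduct_adjMatrix_mulVec_le_specRad H y)
  rw [dotProduct_smul, smul_eq_mul] at h2
  exact lt_of_mul_lt_mul_right h2 (Finset.sum_nonneg fun j _ => mul_self_nonneg (y j))

lemma sum_fin_ite_lt {n b : ℕ} (hb : b ≤ n) (c : ℝ) :
    ∑ j : Fin n, (if (j : ℕ) < b then c else 0) = b * c := by
  rw [Fin.sum_univ_eq_sum_range (fun j => if j < b then c else 0) n, ← Finset.sum_filter]
  have : (Finset.range n).filter (· < b) = Finset.range b := by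
    ext j; simp only [Finset.mem_filter, Finset.mem_range]; omega
  simp [this]

lemma lt_specRad_Kplus {n : ℕ} (hn : 3 ≤ n) {μ : ℝ} (hμ1 : 1 < μ)
    (hμ : μ < (n / 2 : ℕ) + 1) (hμ2 : μ ^ 2 ≤ (n / 2 : ℕ) * ((n + 1) / 2 : ℕ) + 2) :
    μ < specRad (Kplus n) := by
  classical
  obtain ⟨M, hM⟩ : ∃ M, M = (n + 1) / 2 := ⟨_, rfl⟩
  obtain ⟨N, hN⟩ : ∃ N, N = n / 2 := ⟨_, rfl⟩
  rw [← hN] at hμ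
  rw [← hN, ← hM] at hμ2
  have hNM : n = M + N := by omega
  have hM2 : 2 ≤ M := by omega
  have hnR : (n : ℝ) = M + N := by exact_mod_cast hNM
  have hN0 : (0 : ℝ) < N := by exact_mod_cast (by omega : 0 < N)
  set y : Fin n → ℝ := fun j =>
    if (j : ℕ) < 2 then N * μ else if (j : ℕ) < M then N * (μ - 1) else μ * (μ - 1) with hy
  have hypos : ∀ j, 0 < y j := by
    intro j
    have : 0 < μ - 1 := by linarith
    simp only [hy]
    split_ifs <;> positivity
  have hadj : ∀ i j : Fin n, (Kplus n).Adj i j ↔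
      ((i : ℕ) < M ∧ M ≤ (j : ℕ)) ∨ ((j : ℕ) < M ∧ M ≤ (i : ℕ)) ∨
      ((i : ℕ) = 0 ∧ (j : ℕ) = 1) ∨ ((i : ℕ) = 1 ∧ (j : ℕ) = 0) := by
    intro i j
    simp only [Kplus, KbipPlus, SimpleGraph.fromRel_adj, ne_eq, Fin.ext_iff, ← hM]
    omega
  have hmul : ∀ i, ((Kplus n).adjMatrix ℝ *ᵥ y) i =
      ∑ j, if (Kplus n).Adj i j then y j else 0 := by
    intro i
    simp [Matrix.mulVec, dotProduct, SimpleGraph.adjMatrix_apply]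
  have hlow : ∀ i : Fin n, 2 ≤ (i : ℕ) → (i : ℕ) < M →
      ((Kplus n).adjMatrix ℝ *ᵥ y) i = μ * y i := by
    intro i h2 hi
    have : ∀ j : Fin n, (if (Kplus n).Adj i j then y j else 0) =
        (if (j : ℕ) < n then μ * (μ - 1) else 0) - (if (j : ℕ) < M then μ * (μ - 1) else 0) := by
      intro j
      have := j.2
      rw [hadj]
      simp only [hy]
      split_ifs <;> first | omega | ring
    rw [hmul, Finset.sum_congr rfl (fun j _ => this j), Finset.sum_sub_distrib,
      sum_fin_ite_lt le_rfl, sum_fin_ite_lt (by omega), hnR]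
    simp only [hy, if_neg (not_lt.2 h2), if_pos hi]
    ring
  have hedge : ∀ i : Fin n, (i : ℕ) < 2 →
      ((Kplus n).adjMatrix ℝ *ᵥ y) i = μ * y i := by
    intro i hi
    have : ∀ j : Fin n, (if (Kplus n).Adj i j then y j else 0) =
        (if (j : ℕ) < n then μ * (μ - 1) else 0) - (if (j : ℕ) < M then μ * (μ - 1) else 0) +
        ((if (j : ℕ) < 2 then N * μ else 0) - if j = i then N * μ else 0) := by
      intro j
      have := j.2
      rw [hadj]
      simp only [hy, Fin.ext_iff]
      split_ifs <;> first | omega | ring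
    rw [hmul, Finset.sum_congr rfl (fun j _ => this j), Finset.sum_add_distrib,
      Finset.sum_sub_distrib, Finset.sum_sub_distrib,
      sum_fin_ite_lt le_rfl, sum_fin_ite_lt (by omega), sum_fin_ite_lt (by omega), hnR]
    simp only [hy, if_pos hi, Finset.sum_ite_eq', Finset.mem_univ, if_true]
    push_cast
    ring
  have hhigh : ∀ i : Fin n, M ≤ (i : ℕ) →
      μ * y i < ((Kplus n).adjMatrix ℝ *ᵥ y) i := by
    intro i hi
    have : ∀ j : Fin n, (if (Kplus n).Adj i j then y j else 0) =
        (if (j : ℕ) < M then N * (μ - 1) else 0) + (if (j : ℕ) < 2 then (N : ℝ) else 0) := by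
      intro j
      rw [hadj]
      simp only [hy]
      split_ifs <;> first | omega | ring
    rw [hmul, Finset.sum_congr rfl (fun j _ => this j), Finset.sum_add_distrib,
      sum_fin_ite_lt (by omega), sum_fin_ite_lt (by omega)]
    simp only [hy, if_neg (show ¬ (i : ℕ) < 2 by omega), if_neg (not_lt.2 hi)]
    push_cast
    nlinarith
  refine lt_specRad_of_smul_lt_adjMatrix_mulVec (Kplus n) hypos (Pi.lt_def.2 ⟨fun i => ?_,
    ⟨M, by omega⟩, hhigh _ le_rfl⟩)
  rcases lt_or_ge (i : ℕ) 2 with h2 | h2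
  · exact (hedge i h2).ge
  rcases lt_or_ge (i : ℕ) M with h | h
  · exact (hlow i h2 h).ge
  · exact (hhigh i h).le

lemma card_mul_card_adj_pairs_le_two_mul_triangleCount {V : Type*} [Fintype V] [DecidableEq V]
    (G : SimpleGraph V) [DecidableRel G.Adj] (A F : Finset V)
    (hF : ∀ b ∈ F, b ∉ A ∧ ∀ a ∈ A, G.Adj b a) :
    ((A ×ˢ A).filter fun q => G.Adj q.1 q.2).card * F.card ≤ 2 * triangleCount G := by
  set P := (A ×ˢ A).filter fun q => G.Adj q.1 q.2
  let f : (V × V) × V → Finset V := fun q => {q.1.1, q.1.2, q.2}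
  have himage : (P ×ˢ F).image f ⊆ G.cliqueFinset 3 := by
    intro T hT
    obtain ⟨⟨⟨a, a'⟩, b⟩, hq, rfl⟩ := Finset.mem_image.1 hT
    simp only [P, Finset.mem_product, Finset.mem_filter] at hq
    obtain ⟨⟨⟨ha, ha'⟩, hadj⟩, hb⟩ := hq
    rw [SimpleGraph.mem_cliqueFinset_iff, SimpleGraph.is3Clique_triple_iff]
    exact ⟨hadj, ((hF b hb).2 a ha).symm, ((hF b hb).2 a' ha').symm⟩
  have hfib : ∀ T ∈ (P ×ˢ F).image f, ((P ×ˢ F).filter fun q => f q = T).card ≤ 2 := by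
    intro T hT
    obtain ⟨⟨⟨a, a'⟩, b⟩, hq, rfl⟩ := Finset.mem_image.1 hT
    refine (Finset.card_le_card (t := {((a, a'), b), ((a', a), b)}) ?_).trans Finset.card_le_two
    rintro ⟨⟨c, c'⟩, d⟩ hr
    simp only [P, f, Finset.mem_product, Finset.mem_filter] at hq hr
    obtain ⟨⟨⟨ha, ha'⟩, hadj⟩, hb⟩ := hq
    obtain ⟨⟨⟨⟨hc, hc'⟩, hadj'⟩, hd⟩, heq⟩ := hr
    have hbA := (hF b hb).1
    have hdA := (hF d hd).1
    have hne := hadj'.ne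
    have h1 : c ∈ ({a, a', b} : Finset V) := heq ▸ by simp
    have h2 : c' ∈ ({a, a', b} : Finset V) := heq ▸ by simp
    have h3 : d ∈ ({a, a', b} : Finset V) := heq ▸ by simp
    simp only [Finset.mem_insert, Finset.mem_singleton, Prod.mk.injEq] at h1 h2 h3 ⊢
    grind
  have h1 := Finset.card_le_mul_card_image (P ×ˢ F) 2 hfib
  have h2 : (G.cliqueFinset 3).card = triangleCount G := by
    rw [triangleCount]; congr!
  rw [Finset.card_product] at h1
  exact h1.trans (Nat.mul_le_mul_left 2 (h2 ▸ Finset.card_le_card himage))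

/-- Counting walks of length two from a vertex at which the eigenvector is maximal. -/
lemma sq_eigenvalue_add_card_le {V : Type*} [Fintype V] [DecidableEq V]
    (G : SimpleGraph V) [DecidableRel G.Adj] {x : V → ℝ} {r : ℝ}
    (heig : G.adjMatrix ℝ *ᵥ x = r • x) {u : V} (hpos : 0 < x u) (hmax : ∀ v, x v ≤ x u) :
    let A := G.neighborFinset u
    r ^ 2 + (Aᶜ).card ≤ ((A ×ˢ A).filter fun q => G.Adj q.1 q.2).card + A.card * (Aᶜ).card +
      ((Aᶜ).filter fun b => ∀ a ∈ A, G.Adj b a).card := by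
  intro A
  let d : V → ℕ := fun z => (A.filter fun a => G.Adj z a).card
  have heig' : ∀ v, ∑ z ∈ G.neighborFinset v, x z = r * x v := by
    intro v
    simpa [SimpleGraph.adjMatrix_mulVec_apply] using congrFun heig v
  have hwalk : r ^ 2 * x u = ∑ z, d z * x z := by
    calc r ^ 2 * x u = ∑ a ∈ A, r * x a := by rw [← Finset.mul_sum, heig']; ring
      _ = ∑ a ∈ A, ∑ z, if G.Adj z a then x z else 0 := by
          refine Finset.sum_congr rfl fun a _ => ?_
          rw [← heig', SimpleGraph.neighborFinset_eq_filter, Finset.sum_filter]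
          simp only [G.adj_comm]
      _ = ∑ z, d z * x z := by
          rw [Finset.sum_comm]
          refine Finset.sum_congr rfl fun z _ => ?_
          rw [← Finset.sum_filter, Finset.sum_const, nsmul_eq_mul]
  have hle : r ^ 2 ≤ ((∑ z, d z : ℕ) : ℝ) := by
    refine le_of_mul_le_mul_right ?_ hpos
    rw [hwalk, Nat.cast_sum, Finset.sum_mul]
    exact Finset.sum_le_sum fun z _ => mul_le_mul_of_nonneg_left (hmax z) (Nat.cast_nonneg _)
  have hA : ∑ z ∈ A, d z = ((A ×ˢ A).filter fun q => G.Adj q.1 q.2).card := by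
    simp only [d, Finset.card_filter, Finset.sum_product]
  have hB : ∑ z ∈ Aᶜ, d z + (Aᶜ).card ≤ A.card * (Aᶜ).card +
      ((Aᶜ).filter fun b => ∀ a ∈ A, G.Adj b a).card := by
    rw [Finset.card_filter, mul_comm, ← smul_eq_mul, ← Finset.sum_const, Finset.card_eq_sum_ones,
      ← Finset.sum_add_distrib, ← Finset.sum_add_distrib]
    refine Finset.sum_le_sum fun z _ => ?_
    split_ifs with h
    · exact Nat.add_le_add_right (Finset.card_filter_le _ _) 1
    · push Not at h
      obtain ⟨a, ha, hza⟩ := h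
      exact Finset.card_lt_card (Finset.filter_ssubset.2 ⟨a, ha, hza⟩)
  have hsum := Finset.sum_add_sum_compl A d
  have : (∑ z, d z) + (Aᶜ).card ≤ ((A ×ˢ A).filter fun q => G.Adj q.1 q.2).card +
      A.card * (Aᶜ).card + ((Aᶜ).filter fun b => ∀ a ∈ A, G.Adj b a).card := by omega
  have hcast := (Nat.cast_le (α := ℝ)).2 this
  push_cast at hcast hle ⊢
  linarith

lemma walk_bound_contradiction {N M l k p f : ℕ} (hMN : M = N ∨ M = N + 1)
    (hlk : l + k = N + M) (hf : 2 ≤ f) (hfk : f ≤ k) (hfp : p * f ≤ 2 * N)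
    (h : N * M + 2 + k < p + l * k + f) : False := by
  obtain ⟨s, hs⟩ : ∃ s : ℤ, s = N - k := ⟨_, rfl⟩
  have hk : (k : ℤ) = N - s := by omega
  have hl : (l : ℤ) = M + s := by omega
  zify at hf hfk hfp h
  rw [hl, hk] at h
  rw [hk] at hfk
  have hs0 := mul_self_nonneg s
  have hs1 : s ≤ s * s := by simpa [sq] using Int.le_self_sq s
  have hs2 : -s ≤ s * s := by simpa [sq] using Int.le_self_sq (-s)
  have hpf : (N : ℤ) + 2 < p + f ∧ (2 : ℤ) < p := by
    rcases hMN with rfl | rfl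
    · constructor <;> linarith
    · push_cast at h
      constructor <;> linarith
  have hprod : 0 ≤ ((p : ℤ) - 2) * (f - 2) := mul_nonneg (by linarith) (by linarith)
  linarith

/-- In the Setup, no vertex of `B` is adjacent to all vertices of `A = N(u*)`: every
`w ∈ B` has at least one non-neighbor in `A`. -/
theorem setup_no_vertex_of_B_dominates_A
    (n : ℕ) (hn : 3 ≤ n) (G : SimpleGraph (Fin n)) [DecidableRel G.Adj]
    (ht : triangleCount G ≤ n / 2)
    (hspec : specRad (Kplus n) ≤ specRad G)
    (hmaxspec : ∀ H : SimpleGraph (Fin n), triangleCount H ≤ n / 2 → specRad H ≤ specRad G)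
    (hconn : G.Connected)
    (x : Fin n → ℝ) (hxpos : ∀ v, 0 < x v) (hxunit : ∑ v, x v ^ 2 = 1)
    (heig : SimpleGraph.adjMatrix ℝ G *ᵥ x = specRad G • x)
    (ustar : Fin n) (hustar : ∀ v, x v ≤ x ustar)
    :
    ∀ w : Fin n, w ∉ insert ustar (G.neighborFinset ustar) →
      ∃ a ∈ G.neighborFinset ustar, ¬ G.Adj w a := by
  intro w hw
  by_contra! hdom
  set A := G.neighborFinset ustar with hA
  obtain ⟨F, hF⟩ : ∃ F, F = (Aᶜ).filter fun b => ∀ a ∈ A, G.Adj b a := ⟨_, rfl⟩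
  rw [Finset.mem_insert, not_or] at hw
  have hwF : w ∈ F := by simpa [hF] using ⟨hw.2, hdom⟩
  have huF : ustar ∈ F := by simp [hF, hA]
  have hF2 : 2 ≤ F.card := Finset.one_lt_card.2 ⟨w, hwF, ustar, huF, hw.1⟩
  have hFk : F.card ≤ (Aᶜ).card := hF ▸ Finset.card_filter_le _ _
  have htri := card_mul_card_adj_pairs_le_two_mul_triangleCount G A F (by simp [hF])
  have hup := sq_eigenvalue_add_card_le G heig (hxpos ustar) hustar
  simp only [← hA, ← hF] at hup
  have hcard : A.card + (Aᶜ).card = n := by simp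
  generalize ((A ×ˢ A).filter fun q => G.Adj q.1 q.2).card = p at htri hup
  generalize F.card = f at *
  generalize (Aᶜ).card = k at *
  generalize A.card = l at *
  have hbound : ∀ μ : ℝ, 1 < μ → μ < (n / 2 : ℕ) + 1 →
      μ ^ 2 ≤ (n / 2 : ℕ) * ((n + 1) / 2 : ℕ) + 2 → μ ^ 2 + k < p + l * k + f := by
    intro μ h1 h2 h3
    have h4 := (lt_specRad_Kplus hn h1 h2 h3).trans_le hspec
    have : μ ^ 2 < specRad G ^ 2 := by gcongr
    linarith
  obtain ⟨N, hN⟩ : ∃ N, N = n / 2 := ⟨_, rfl⟩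
  obtain ⟨M, hM⟩ : ∃ M, M = (n + 1) / 2 := ⟨_, rfl⟩
  rw [← hN, ← hM] at hbound
  rw [← hN] at ht
  have hfp : p * f ≤ 2 * N := htri.trans (Nat.mul_le_mul_left 2 ht)
  rcases hn.eq_or_lt with rfl | hn4
  · have h := hbound (19 / 10) (by norm_num) (by rw [hN]; norm_num) (by rw [hN, hM]; norm_num)
    have h' : 3 + k < p + l * k + f := by
      have : ((3 + k : ℕ) : ℝ) < ((p + l * k + f : ℕ) : ℝ) := by push_cast; linarith
      exact_mod_cast this
    have hp : p ≤ 1 := by subst hN; nlinarith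
    have hk : k ≤ 3 := by omega
    interval_cases k <;> omega
  · have hN2 : 2 ≤ N := by omega
    have hN2R : (2 : ℝ) ≤ N := by exact_mod_cast hN2
    have hMN : M = N ∨ M = N + 1 := by omega
    have hMR : (M : ℝ) ≤ N + 1 := by exact_mod_cast (by omega : M ≤ N + 1)
    have hq : (0 : ℝ) ≤ N * M := by positivity
    have hsq := Real.sq_sqrt (show (0 : ℝ) ≤ N * M + 2 by positivity)
    have h := hbound (√(N * M + 2)) (by rw [Real.lt_sqrt zero_le_one]; linarith)
      (by rw [Real.sqrt_lt' (by positivity)]; nlinarith) hsq.le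
    rw [hsq] at h
    have h' : N * M + 2 + k < p + l * k + f := by exact_mod_cast h
    have hlk : l + k = N + M := by omega
    exact walk_bound_contradiction hMN hlk hF2 hFk hfp h'
end

section
/- In the Setup, every triangle of G contains the vertex u*; equivalently, t(G) equals the number of edges of the induced subgraph G[A]. -/
open Matrix

section Spectral

variable {V : Type*} [Fintype V]

/-- A symmetric nonnegative matrix with a positive eigenvector for `lam` has all its
eigenvalues at least `-lam`. -/
theorem posSemidef_add_smul_one_of_pos_eigenvector [DecidableEq V] {M : Matrix V V ℝ}
    (hsymm : Mᵀ = M) (hnonneg : ∀ i j, 0 ≤ M i j) {x : V → ℝ} (hx : ∀ v, 0 < x v) {lam : ℝ}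
    (heig : M *ᵥ x = lam • x) : (M + lam • (1 : Matrix V V ℝ)).PosSemidef := by
  refine Matrix.PosSemidef.of_dotProduct_mulVec_nonneg ?_ fun v => ?_
  · rw [Matrix.IsHermitian, Matrix.conjTranspose_eq_transpose_of_trivial, transpose_add,
      transpose_smul, transpose_one, hsymm]
  have hM : ∀ i j, M i j = M j i := fun i j => by
    conv_lhs => rw [← hsymm, transpose_apply]
  have hrow : ∀ i, ∑ j, M i j * x j = lam * x i := fun i => by
    simpa [Matrix.mulVec, dotProduct] using congrFun heig i
  have hsquare : ∑ i, ∑ j, M i j * x i * x j * (v i / x i + v j / x j) ^ 2 =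
      2 * (v ⬝ᵥ (M + lam • (1 : Matrix V V ℝ)) *ᵥ v) := by
    have hterm : ∀ i j, M i j * x i * x j * (v i / x i + v j / x j) ^ 2 =
        (M i j * x j) * (v i ^ 2 / x i) + (M j i * x i) * (v j ^ 2 / x j)
          + 2 * (v i * (M i j * v j)) := fun i j => by
      have hi := (hx i).ne'
      have hj := (hx j).ne'
      rw [hM j i]
      field_simp
      ring
    have hdiag : ∑ i, ∑ j, (M i j * x j) * (v i ^ 2 / x i) = lam * ∑ i, v i ^ 2 := by
      rw [Finset.mul_sum]
      refine Finset.sum_congr rfl fun i _ => ?_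
      have hi := (hx i).ne'
      rw [← Finset.sum_mul, hrow]
      field_simp
    have hdiag' : ∑ i, ∑ j, (M j i * x i) * (v j ^ 2 / x j) = lam * ∑ i, v i ^ 2 := by
      rw [Finset.sum_comm]
      exact hdiag
    simp_rw [hterm, Finset.sum_add_distrib]
    rw [hdiag, hdiag']
    simp only [Matrix.add_mulVec, Matrix.smul_mulVec, Matrix.one_mulVec, dotProduct_add,
      dotProduct_smul, smul_eq_mul]
    have hcross : ∑ i, ∑ j, 2 * (v i * (M i j * v j)) = 2 * (v ⬝ᵥ M *ᵥ v) := by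
      simp only [dotProduct, Matrix.mulVec, Finset.mul_sum]
    have hself : v ⬝ᵥ v = ∑ i, v i ^ 2 := by simp only [dotProduct, ← pow_two]
    rw [hcross, hself]
    ring
  have hpos : 0 ≤ ∑ i, ∑ j, M i j * x i * x j * (v i / x i + v j / x j) ^ 2 :=
    Finset.sum_nonneg fun i _ => Finset.sum_nonneg fun j _ =>
      mul_nonneg (mul_nonneg (mul_nonneg (hnonneg i j) (hx i).le) (hx j).le) (sq_nonneg _)
  rw [star_trivial]
  linarith

/-- The cubic trace inequality for a symmetric nonnegative matrix with Perron vector `x`. -/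
theorem two_mul_cube_le_trace [DecidableEq V] {M : Matrix V V ℝ} (hsymm : Mᵀ = M)
    (hnonneg : ∀ i j, 0 ≤ M i j) {x : V → ℝ} (hx : ∀ v, 0 < x v)
    (hunit : ∑ v, x v ^ 2 = 1) {lam : ℝ} (heig : M *ᵥ x = lam • x) :
    2 * lam ^ 3 ≤ (M * M * M).trace + lam * (M * M).trace := by
  set J : Matrix V V ℝ := vecMulVec x x with hJ
  have hunit' : x ⬝ᵥ x = 1 := by simpa [dotProduct, ← pow_two] using hunit
  have hMJ : M * J = lam • J := by rw [hJ, mul_vecMulVec, heig, smul_vecMulVec]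
  have hJM : J * M = lam • J := by
    rw [hJ, vecMulVec_mul, ← hsymm, vecMul_transpose, heig, vecMulVec_smul]
  have hJJ : J * J = J := by rw [hJ, vecMulVec_mul_vecMulVec, hunit', one_smul]
  have hJt : J.trace = 1 := by rw [hJ, trace_vecMulVec, hunit']
  have hW : (M - lam • J)ᴴ = M - lam • J := by
    rw [Matrix.conjTranspose_eq_transpose_of_trivial, transpose_sub, transpose_smul, hsymm, hJ,
      transpose_vecMulVec]
  have hpsd := ((posSemidef_add_smul_one_of_pos_eigenvector hsymm hnonneg hx
    heig).conjTranspose_mul_mul_same (M - lam • J)).trace_nonneg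
  have hexpand : (M - lam • J) * (M + lam • (1 : Matrix V V ℝ)) * (M - lam • J) =
      M * M * M + lam • (M * M) - (2 * lam ^ 3) • J := by
    simp only [sub_mul, mul_sub, mul_add, add_mul, Matrix.mul_assoc, hMJ, hJM, hJJ, mul_smul_comm,
      smul_mul_assoc, mul_one, smul_smul]
    module
  rw [hW, hexpand, trace_sub, trace_add, trace_smul, trace_smul, hJt] at hpsd
  simp only [smul_eq_mul] at hpsd
  linarith

namespace SimpleGraph

variable (G : SimpleGraph V) [DecidableRel G.Adj]

theorem trace_adjMatrix_mul_self :
    (G.adjMatrix ℝ * G.adjMatrix ℝ).trace = 2 * (G.edgeFinset.card : ℝ) := by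
  simp only [Matrix.trace, Matrix.diag_apply, adjMatrix_mul_self_apply_self]
  exact_mod_cast G.sum_degrees_eq_twice_card_edges

theorem trace_adjMatrix_cube_le [DecidableEq V] :
    (G.adjMatrix ℝ * G.adjMatrix ℝ * G.adjMatrix ℝ).trace ≤ 6 * ((G.cliqueFinset 3).card : ℝ) := by
  have htrace : (G.adjMatrix ℝ * G.adjMatrix ℝ * G.adjMatrix ℝ).trace =
      ((Finset.univ.filter fun p : V × V × V =>
        G.Adj p.1 p.2.1 ∧ G.Adj p.1 p.2.2 ∧ G.Adj p.2.1 p.2.2).card : ℝ) := by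
    rw [Finset.card_filter]
    push_cast
    simp only [Fintype.sum_prod_type, Matrix.trace, Matrix.diag_apply, Matrix.mul_apply,
      adjMatrix_apply, Finset.sum_mul]
    refine Finset.sum_congr rfl fun i _ => ?_
    rw [Finset.sum_comm]
    refine Finset.sum_congr rfl fun j _ => Finset.sum_congr rfl fun k _ => ?_
    by_cases h1 : G.Adj i j <;> by_cases h2 : G.Adj j k <;> by_cases h3 : G.Adj i k <;>
      simp [h1, h2, h3, G.adj_comm k i]
  rw [htrace]
  norm_cast
  refine Finset.card_le_mul_card_image_of_maps_to (f := fun p : V × V × V => {p.1, p.2.1, p.2.2})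
    (fun p hp => ?_) 6 fun T hT => ?_
  · rw [Finset.mem_filter] at hp
    rw [mem_cliqueFinset_iff, is3Clique_triple_iff]
    exact hp.2
  · obtain ⟨a, b, c, -, -, -, rfl⟩ := is3Clique_iff.mp (G.mem_cliqueFinset_iff.mp hT)
    refine (Finset.card_le_card fun p hp => ?_).trans
      (Finset.card_le_six (a := (a, b, c)) (b := (a, c, b)) (c := (b, a, c)) (d := (b, c, a))
        (e := (c, a, b)) (f := (c, b, a)))
    obtain ⟨i, j, k⟩ := p
    simp only [Finset.mem_filter, Finset.mem_univ, true_and] at hp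
    obtain ⟨⟨hij, hik, hjk⟩, hset⟩ := hp
    have hi : i ∈ ({a, b, c} : Finset V) := by rw [← hset]; simp
    have hj : j ∈ ({a, b, c} : Finset V) := by rw [← hset]; simp
    have hk : k ∈ ({a, b, c} : Finset V) := by rw [← hset]; simp
    simp only [Finset.mem_insert, Finset.mem_singleton] at hi hj hk
    have := hij.ne
    have := hik.ne
    have := hjk.ne
    simp only [Finset.mem_insert, Finset.mem_singleton, Prod.mk.injEq]
    grind

/-- A lower bound on the number of triangles in terms of the spectral radius and the size. -/
theorem spectral_triangle_bound [DecidableEq V] {x : V → ℝ} (hx : ∀ v, 0 < x v)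
    (hunit : ∑ v, x v ^ 2 = 1) {lam : ℝ} (heig : G.adjMatrix ℝ *ᵥ x = lam • x) :
    lam ^ 3 ≤ 3 * ((G.cliqueFinset 3).card : ℝ) + lam * G.edgeFinset.card := by
  have h := two_mul_cube_le_trace (G.transpose_adjMatrix (α := ℝ))
    (fun i j => by rw [adjMatrix_apply]; split_ifs <;> norm_num) hx hunit heig
  have h3 := G.trace_adjMatrix_cube_le
  rw [trace_adjMatrix_mul_self] at h
  linarith

theorem eigenvalue_le_degree {x : V → ℝ} {lam : ℝ}
    (heig : G.adjMatrix ℝ *ᵥ x = lam • x) {u : V} (hxu : 0 < x u) (hu : ∀ v, x v ≤ x u) :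
    lam ≤ G.degree u := by
  have h := congrFun heig u
  rw [adjMatrix_mulVec_apply, Pi.smul_apply, smul_eq_mul] at h
  have h2 : ∑ v ∈ G.neighborFinset u, x v ≤ G.degree u * x u := by
    simpa using Finset.sum_le_card_nsmul (G.neighborFinset u) x (x u) fun v _ => hu v
  exact le_of_mul_le_mul_right (h ▸ h2) hxu

/-- The square of the eigenvalue is at most the number of walks of length two from a vertex
where the eigenvector is maximal. -/
theorem eigenvalue_sq_le_sum_degree {x : V → ℝ} {lam : ℝ}
    (heig : G.adjMatrix ℝ *ᵥ x = lam • x) {u : V} (hxu : 0 < x u) (hu : ∀ v, x v ≤ x u) :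
    lam ^ 2 ≤ ∑ v ∈ G.neighborFinset u, (G.degree v : ℝ) := by
  have h : ∀ v, ∑ w ∈ G.neighborFinset v, x w = lam * x v := fun v => by
    simpa only [adjMatrix_mulVec_apply, Pi.smul_apply, smul_eq_mul] using congrFun heig v
  have hle : ∀ v, lam * x v ≤ G.degree v * x u := fun v => by
    rw [← h v]
    simpa using Finset.sum_le_card_nsmul (G.neighborFinset v) x (x u) fun w _ => hu w
  refine le_of_mul_le_mul_right ?_ hxu
  calc lam ^ 2 * x u = lam * ∑ v ∈ G.neighborFinset u, x v := by rw [h]; ring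
    _ = ∑ v ∈ G.neighborFinset u, lam * x v := Finset.mul_sum ..
    _ ≤ ∑ v ∈ G.neighborFinset u, G.degree v * x u := Finset.sum_le_sum fun v _ => hle v
    _ = _ := (Finset.sum_mul ..).symm

end SimpleGraph

end Spectral

section ExtremalGraph

theorem le_specRad_of_hasEigenvalue {V : Type*} [Fintype V] [DecidableEq V] (G : SimpleGraph V)
    [DecidableRel G.Adj] {μ : ℝ} {v : V → ℝ} (hv : v ≠ 0) (h : G.adjMatrix ℝ *ᵥ v = μ • v) :
    μ ≤ specRad G := by
  obtain rfl : ‹DecidableEq V› = Classical.decEq V := Subsingleton.elim _ _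
  obtain rfl : ‹DecidableRel G.Adj› = Classical.decRel G.Adj := Subsingleton.elim _ _
  refine le_csSup (Module.End.finite_hasEigenvalue _).bddAbove ?_
  exact Module.End.hasEigenvalue_of_hasEigenvector (x := v)
    ⟨Module.End.mem_eigenspace_iff.mpr ((@Matrix.toLin'_apply _ _ _ _ (_) _ _ _).trans h), hv⟩

/-- The spectral radius of `K⁺` with parts of sizes `c + 2` and `k` is at least every root of
its quotient characteristic polynomial. -/
theorem le_specRad_KbipPlus (c k : ℕ) {μ : ℝ} (hμ : 1 < μ)
    (hroot : (μ - 1) * (μ ^ 2 - k * (c + 2)) = 2 * k) :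
    μ ≤ specRad (KbipPlus (2 + c + k) (c + 2)) := by
  classical
  set g : ℕ → ℝ := fun i => if i < 2 then k * μ else if i < c + 2 then k * (μ - 1) else μ * (μ - 1)
    with hg
  have hsplit : ∀ f : ℕ → ℝ, ∑ i : Fin (2 + c + k), f i = f 0 + f 1 +
      ∑ i ∈ Finset.range c, f (2 + i) + ∑ i ∈ Finset.range k, f (2 + c + i) := fun f => by
    rw [Fin.sum_univ_eq_sum_range, Finset.sum_range_add, Finset.sum_range_add]
    simp [Finset.sum_range_succ]
  have hμ1 : 0 < μ - 1 := by linarith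
  by_cases hk : k = 0
  · subst hk
    simp only [Nat.cast_zero, zero_mul, sub_zero, mul_zero] at hroot
    nlinarith [mul_pos hμ1 (pow_pos (show 0 < μ by linarith) 2)]
  refine le_specRad_of_hasEigenvalue (v := fun i => g i) _ (fun h0 => ?_) ?_
  · have h := congrFun h0 ⟨2 + c, by omega⟩
    simp only [hg, Pi.zero_apply] at h
    rw [if_neg (by omega), if_neg (by omega)] at h
    have : 0 < μ * (μ - 1) := by positivity
    linarith
  funext i
  have hadj : ∀ j : Fin (2 + c + k), (SimpleGraph.adjMatrix ℝ (KbipPlus (2 + c + k) (c + 2))) i j =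
      (if ((i : ℕ) < c + 2 ∧ c + 2 ≤ (j : ℕ)) ∨ ((j : ℕ) < c + 2 ∧ c + 2 ≤ (i : ℕ)) ∨
        ((i : ℕ) = 0 ∧ (j : ℕ) = 1) ∨ ((j : ℕ) = 0 ∧ (i : ℕ) = 1) then 1 else 0) := fun j => by
    rw [SimpleGraph.adjMatrix_apply]
    refine if_congr ?_ rfl rfl
    rw [KbipPlus, SimpleGraph.fromRel_adj, ne_eq, Fin.ext_iff]
    omega
  simp only [Matrix.mulVec, dotProduct, hadj, Pi.smul_apply, smul_eq_mul]
  rw [hsplit fun j => (if ((i : ℕ) < c + 2 ∧ c + 2 ≤ j) ∨ (j < c + 2 ∧ c + 2 ≤ (i : ℕ)) ∨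
        ((i : ℕ) = 0 ∧ j = 1) ∨ (j = 0 ∧ (i : ℕ) = 1) then 1 else 0) * g j]
  have hgc : ∀ j ∈ Finset.range c, g (2 + j) = k * (μ - 1) := fun j hj => by
    rw [Finset.mem_range] at hj
    simp only [hg]
    rw [if_neg (by omega), if_pos (by omega)]
  have hgk : ∀ j, g (2 + c + j) = μ * (μ - 1) := fun j => by
    simp only [hg]
    rw [if_neg (by omega), if_neg (by omega)]
  have hg01 : g 0 = k * μ ∧ g 1 = k * μ := by simp [hg]
  rcases lt_or_ge (i : ℕ) (c + 2) with hi | hi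
  · have hC : ∑ j ∈ Finset.range c, ((if ((i : ℕ) < c + 2 ∧ c + 2 ≤ 2 + j) ∨
        (2 + j < c + 2 ∧ c + 2 ≤ (i : ℕ)) ∨ ((i : ℕ) = 0 ∧ 2 + j = 1) ∨
        (2 + j = 0 ∧ (i : ℕ) = 1) then 1 else 0) * g (2 + j) : ℝ) = 0 := by
      refine Finset.sum_eq_zero fun j hj => ?_
      rw [Finset.mem_range] at hj
      rw [if_neg (by omega), zero_mul]
    have hK : ∑ j ∈ Finset.range k, ((if ((i : ℕ) < c + 2 ∧ c + 2 ≤ 2 + c + j) ∨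
        (2 + c + j < c + 2 ∧ c + 2 ≤ (i : ℕ)) ∨ ((i : ℕ) = 0 ∧ 2 + c + j = 1) ∨
        (2 + c + j = 0 ∧ (i : ℕ) = 1) then 1 else 0) * g (2 + c + j) : ℝ) =
        k * (μ * (μ - 1)) := by
      rw [Finset.sum_congr rfl fun j _ => by rw [hgk, if_pos (by omega), one_mul]]
      simp
    rw [hC, hK, hg01.1, hg01.2]
    rcases Nat.lt_or_ge (i : ℕ) 2 with hi2 | hi2
    · have hgi : g i = k * μ := by simp only [hg, if_pos hi2]
      rw [hgi]
      interval_cases hi' : (i : ℕ)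
      · rw [if_neg (by omega), if_pos (by omega)]
        ring
      · rw [if_pos (by omega), if_neg (by omega)]
        ring
    · have hgi : g i = k * (μ - 1) := by
        simp only [hg]
        rw [if_neg (by omega), if_pos hi]
      rw [hgi, if_neg (by omega), if_neg (by omega)]
      ring
  · have hC : ∑ j ∈ Finset.range c, ((if ((i : ℕ) < c + 2 ∧ c + 2 ≤ 2 + j) ∨
        (2 + j < c + 2 ∧ c + 2 ≤ (i : ℕ)) ∨ ((i : ℕ) = 0 ∧ 2 + j = 1) ∨
        (2 + j = 0 ∧ (i : ℕ) = 1) then 1 else 0) * g (2 + j) : ℝ) = c * (k * (μ - 1)) := by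
      rw [Finset.sum_congr rfl fun j hj => by
        rw [hgc j hj, if_pos (by rw [Finset.mem_range] at hj; omega), one_mul]]
      simp
    have hK : ∑ j ∈ Finset.range k, ((if ((i : ℕ) < c + 2 ∧ c + 2 ≤ 2 + c + j) ∨
        (2 + c + j < c + 2 ∧ c + 2 ≤ (i : ℕ)) ∨ ((i : ℕ) = 0 ∧ 2 + c + j = 1) ∨
        (2 + c + j = 0 ∧ (i : ℕ) = 1) then 1 else 0) * g (2 + c + j) : ℝ) = 0 := by
      refine Finset.sum_eq_zero fun j hj => ?_
      rw [if_neg (by omega), zero_mul]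
    have hgi : g i = μ * (μ - 1) := by
      simp only [hg]
      rw [if_neg (by omega), if_neg (by omega)]
    rw [hC, hK, hg01.1, hg01.2, hgi, if_pos (by omega), if_pos (by omega)]
    linear_combination -hroot

theorem exists_root_gt_sqrt {p k : ℝ} (hk : 1 ≤ k) (hp : 0 ≤ p) (hlt : p + 2 < (k + 1) ^ 2) :
    ∃ μ : ℝ, 1 < μ ∧ p + 2 < μ ^ 2 ∧ (μ - 1) * (μ ^ 2 - p) = 2 * k := by
  set s := √(p + 2) with hs
  have hsq : s ^ 2 = p + 2 := Real.sq_sqrt (by linarith)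
  have hs0 : 0 ≤ s := Real.sqrt_nonneg _
  have hs1 : 1 < s := by nlinarith
  have hsk : s < k + 1 := lt_of_pow_lt_pow_left₀ 2 (by linarith) (by rw [hsq]; exact hlt)
  obtain ⟨μ, ⟨hμ, -⟩, hroot⟩ := intermediate_value_Ioo (f := fun y : ℝ => (y - 1) * (y ^ 2 - p))
    hsk.le (by fun_prop) (show 2 * k ∈ _ from ⟨by simp only [hsq]; linarith, by nlinarith⟩)
  exact ⟨μ, by linarith, by nlinarith, hroot⟩

/-- `λ(K⁺)² > ⌊n²/4⌋ + 2` for `n ≥ 4`. -/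
theorem div_four_add_two_lt_specRad_Kplus_sq {n : ℕ} (hn : 4 ≤ n) :
    0 ≤ specRad (Kplus n) ∧
      ((n / 2 : ℕ) * ((n + 1) / 2 : ℕ) : ℝ) + 2 < specRad (Kplus n) ^ 2 := by
  obtain ⟨c, hc⟩ : ∃ c, (n + 1) / 2 = c + 2 := ⟨(n + 1) / 2 - 2, by omega⟩
  obtain ⟨k, hk⟩ : ∃ k, n / 2 = k := ⟨_, rfl⟩
  have hnk : n = 2 + c + k := by omega
  have hck : c + 2 ≤ k + 1 := by omega
  have hk2 : 2 ≤ k := by omega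
  have hck' : (c : ℝ) + 2 ≤ k + 1 := by exact_mod_cast hck
  have hk2' : (2 : ℝ) ≤ k := by exact_mod_cast hk2
  obtain ⟨μ, hμ1, hμ2, hroot⟩ := exists_root_gt_sqrt (p := k * (c + 2)) (k := k) (by linarith)
    (by positivity) (by nlinarith)
  have hle := le_specRad_KbipPlus c k hμ1 hroot
  rw [hk, hc]
  have hKplus : specRad (Kplus n) = specRad (KbipPlus (2 + c + k) (c + 2)) := by
    rw [Kplus, hc]
    subst hnk
    rfl
  rw [hKplus]
  push_cast
  exact ⟨by linarith, by nlinarith⟩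

end ExtremalGraph

section Combinatorics

namespace SimpleGraph

variable {V : Type*}

/-- The spanning subgraph of `G` consisting of the edges with both ends in `A`. -/
def edgesInside (G : SimpleGraph V) (A : Finset V) : SimpleGraph V where
  Adj v w := G.Adj v w ∧ v ∈ A ∧ w ∈ A
  symm := ⟨fun _ _ h => ⟨h.1.symm, h.2.2, h.2.1⟩⟩
  loopless := ⟨fun _ h => h.1.ne rfl⟩

theorem insert_toFinset_injective [DecidableEq V] {G : SimpleGraph V} {A : Finset V}
    {w w' : V} (hw : w ∉ A) (hw' : w' ∉ A)
    {e e' : Sym2 V} (he : e ∈ (G.edgesInside A).edgeSet) (he' : e' ∈ (G.edgesInside A).edgeSet)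
    (h : insert w e.toFinset = insert w' e'.toFinset) : w = w' ∧ e = e' := by
  have hmem : ∀ v, (v = w ∨ v ∈ e) ↔ (v = w' ∨ v ∈ e') := fun v => by
    simpa using Finset.ext_iff.mp h v
  have hA : ∀ {f : Sym2 V}, f ∈ (G.edgesInside A).edgeSet → ∀ v ∈ f, v ∈ A := by
    intro f
    induction f using Sym2.ind with
    | _ a b =>
      intro hf v hv
      rw [mem_edgeSet] at hf
      rcases Sym2.mem_iff.mp hv with rfl | rfl
      exacts [hf.2.1, hf.2.2]
  have hww : w = w' := by
    rcases (hmem w).mp (Or.inl rfl) with h1 | h1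
    · exact h1
    · exact absurd (hA he' w h1) hw
  subst hww
  refine ⟨rfl, Sym2.ext fun v => ⟨fun hv => ?_, fun hv => ?_⟩⟩
  · exact ((hmem v).mp (Or.inr hv)).resolve_left fun hvw => hw (hvw ▸ hA he v hv)
  · exact ((hmem v).mpr (Or.inr hv)).resolve_left fun hvw => hw (hvw ▸ hA he' v hv)

variable [Fintype V] (G : SimpleGraph V) [DecidableRel G.Adj]

/-- The neighbours of `u` adjacent to `v`. -/
def commonFinset (u v : V) : Finset V := (G.neighborFinset u).filter fun w => G.Adj v w

/-- The neighbours of `u` not adjacent to `v`. -/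
def missedFinset (u v : V) : Finset V := (G.neighborFinset u).filter fun w => ¬G.Adj v w

theorem card_commonFinset_add_card_missedFinset {u : V} (v : V) :
    (G.commonFinset u v).card + (G.missedFinset u v).card = G.degree u :=
  Finset.card_filter_add_card_filter_not _

variable [DecidableEq V]

instance (A : Finset V) : DecidableRel (G.edgesInside A).Adj :=
  fun v w => inferInstanceAs (Decidable (G.Adj v w ∧ v ∈ A ∧ w ∈ A))

/-- The vertices other than `u` that are not adjacent to `u`. -/
def farFinset (u : V) : Finset V := Finset.univ.filter fun v => v ≠ u ∧ ¬G.Adj u v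

/-- The triangles of `G` avoiding `u`. -/
def trianglesAvoiding (u : V) : Finset (Finset V) := (G.cliqueFinset 3).filter fun T => u ∉ T

variable {G} {u : V}

theorem mem_farFinset {v : V} : v ∈ G.farFinset u ↔ v ≠ u ∧ ¬G.Adj u v := by simp [farFinset]

theorem mem_trianglesAvoiding {a b c : V} : {a, b, c} ∈ G.trianglesAvoiding u ↔
    (G.Adj a b ∧ G.Adj a c ∧ G.Adj b c) ∧ u ≠ a ∧ u ≠ b ∧ u ≠ c := by
  simp [trianglesAvoiding, mem_cliqueFinset_iff, is3Clique_triple_iff]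

theorem sum_eq_add_sum_neighborFinset_add_sum_farFinset (f : V → ℕ) :
    ∑ v, f v = f u + ∑ v ∈ G.neighborFinset u, f v + ∑ v ∈ G.farFinset u, f v := by
  have hsingle : f u = ∑ v ∈ Finset.univ.filter (fun v => v = u), f v := by
    rw [Finset.filter_eq' Finset.univ u, if_pos (Finset.mem_univ u), Finset.sum_singleton]
  have hnbr : G.neighborFinset u =
      (Finset.univ.filter fun v => ¬v = u).filter fun v => G.Adj u v := by
    ext v
    simp only [mem_neighborFinset, Finset.mem_filter, Finset.mem_univ, true_and]
    exact ⟨fun h => ⟨h.ne', h⟩, fun h => h.2⟩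
  have hfar : G.farFinset u = (Finset.univ.filter fun v => ¬v = u).filter fun v => ¬G.Adj u v := by
    ext v
    simp [mem_farFinset]
  rw [hsingle, hnbr, hfar, add_assoc, Finset.sum_filter_add_sum_filter_not,
    Finset.sum_filter_add_sum_filter_not]

theorem card_eq_degree_add_card_farFinset :
    Fintype.card V = 1 + G.degree u + (G.farFinset u).card := by
  simpa using G.sum_eq_add_sum_neighborFinset_add_sum_farFinset (u := u) fun _ => 1

theorem sum_card_commonFinset_eq_two_mul_card :
    ∑ v ∈ G.neighborFinset u, (G.commonFinset u v).card =
      2 * (G.edgesInside (G.neighborFinset u)).edgeFinset.card := by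
  rw [← sum_degrees_eq_twice_card_edges,
    ← Finset.sum_subset (Finset.subset_univ (G.neighborFinset u))]
  · refine Finset.sum_congr rfl fun v hv => ?_
    rw [← card_neighborFinset_eq_degree]
    congr 1
    ext w
    rw [mem_neighborFinset, commonFinset, Finset.mem_filter]
    exact ⟨fun h => ⟨h.2, hv, h.1⟩, fun h => ⟨h.2.2, h.1⟩⟩
  · intro v _ hv
    rw [← card_neighborFinset_eq_degree, Finset.card_eq_zero, Finset.eq_empty_iff_forall_notMem]
    intro w hw
    rw [mem_neighborFinset] at hw
    exact hv hw.2.1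

theorem sum_degree_neighborFinset :
    ∑ v ∈ G.neighborFinset u, G.degree v =
      G.degree u + 2 * (G.edgesInside (G.neighborFinset u)).edgeFinset.card +
        ∑ b ∈ G.farFinset u, (G.commonFinset u b).card := by
  have hdouble := Finset.sum_card_bipartiteAbove_eq_sum_card_bipartiteBelow (fun v w => G.Adj w v)
    (s := G.neighborFinset u) (t := Finset.univ)
  have hself : (G.commonFinset u u).card = G.degree u := by
    rw [← card_neighborFinset_eq_degree, commonFinset, Finset.filter_true_of_mem]
    exact fun w hw => (G.mem_neighborFinset u w).mp hw
  calc ∑ v ∈ G.neighborFinset u, G.degree v = ∑ v, (G.commonFinset u v).card := by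
        refine Eq.trans (Finset.sum_congr rfl fun v _ => ?_) hdouble
        rw [← card_neighborFinset_eq_degree]
        congr 1
        ext w
        simp [Finset.bipartiteAbove, G.adj_comm]
    _ = _ := by
        rw [sum_eq_add_sum_neighborFinset_add_sum_farFinset (G := G) (u := u), hself,
          sum_card_commonFinset_eq_two_mul_card]

theorem two_mul_card_edgeFinset_of_farFinset_indep
    (hindep : ∀ b ∈ G.farFinset u, ∀ b' ∈ G.farFinset u, ¬G.Adj b b') :
    2 * G.edgeFinset.card = G.degree u + ∑ v ∈ G.neighborFinset u, G.degree v +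
      ∑ b ∈ G.farFinset u, (G.commonFinset u b).card := by
  rw [← sum_degrees_eq_twice_card_edges,
    sum_eq_add_sum_neighborFinset_add_sum_farFinset (G := G) (u := u)]
  congr 1
  refine Finset.sum_congr rfl fun b hb => ?_
  rw [← card_neighborFinset_eq_degree]
  congr 1
  ext w
  rw [mem_neighborFinset, commonFinset, Finset.mem_filter, mem_neighborFinset]
  refine ⟨fun h => ⟨?_, h⟩, fun h => h.2⟩
  by_contra hw
  refine hindep b hb w (mem_farFinset.mpr ⟨?_, hw⟩) h
  rintro rfl
  exact (mem_farFinset.mp hb).2 h.symm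

theorem card_filter_mem_cliqueFinset (u : V) :
    ((G.cliqueFinset 3).filter fun T => u ∈ T).card =
      (G.edgesInside (G.neighborFinset u)).edgeFinset.card := by
  symm
  have hu : u ∉ G.neighborFinset u := G.notMem_neighborFinset_self u
  refine Finset.card_bij (fun e _ => insert u e.toFinset) (fun e he => ?_)
    (fun e he e' he' h => ?_) fun T hT => ?_
  · induction e using Sym2.ind with
    | _ a b =>
      rw [mem_edgeFinset, mem_edgeSet] at he
      rw [Finset.mem_filter, Sym2.toFinset_mk_eq, mem_cliqueFinset_iff, is3Clique_triple_iff]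
      simp only [edgesInside, mem_neighborFinset] at he
      exact ⟨⟨he.2.1, he.2.2, he.1⟩, Finset.mem_insert_self _ _⟩
  · exact (insert_toFinset_injective hu hu (mem_edgeFinset.mp he) (mem_edgeFinset.mp he') h).2
  · rw [Finset.mem_filter, mem_cliqueFinset_iff, is3Clique_iff] at hT
    obtain ⟨⟨a, b, c, hab, hac, hbc, rfl⟩, huT⟩ := hT
    simp only [Finset.mem_insert, Finset.mem_singleton] at huT
    have hmk : ∀ {p q : V}, G.Adj u p → G.Adj u q → G.Adj p q →
        s(p, q) ∈ (G.edgesInside (G.neighborFinset u)).edgeFinset := fun hp hq hpq => by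
      rw [mem_edgeFinset, mem_edgeSet]
      exact ⟨hpq, (G.mem_neighborFinset _ _).mpr hp, (G.mem_neighborFinset _ _).mpr hq⟩
    rcases huT with rfl | rfl | rfl
    · exact ⟨_, hmk hab hac hbc, by rw [Sym2.toFinset_mk_eq]⟩
    · exact ⟨_, hmk hab.symm hbc hac, by rw [Sym2.toFinset_mk_eq]; grind⟩
    · exact ⟨_, hmk hac.symm hbc.symm hab, by rw [Sym2.toFinset_mk_eq]; grind⟩

theorem card_edgesInside_add_card_trianglesAvoiding (u : V) :
    (G.edgesInside (G.neighborFinset u)).edgeFinset.card + (G.trianglesAvoiding u).card =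
      (G.cliqueFinset 3).card := by
  rw [← card_filter_mem_cliqueFinset, trianglesAvoiding, Finset.card_filter_add_card_filter_not]

/-- A far vertex adjacent to all of `N(u)` spans a triangle with each edge inside `N(u)`. -/
theorem card_full_mul_card_le_card_trianglesAvoiding :
    ((G.farFinset u).filter fun b => G.missedFinset u b = ∅).card *
      (G.edgesInside (G.neighborFinset u)).edgeFinset.card ≤ (G.trianglesAvoiding u).card := by
  have hfar : ∀ {b}, b ∈ (G.farFinset u).filter (fun b => G.missedFinset u b = ∅) →
      b ∉ G.neighborFinset u := fun hb h =>
    (mem_farFinset.mp (Finset.mem_filter.mp hb).1).2 ((G.mem_neighborFinset _ _).mp h)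
  rw [← Finset.card_product]
  refine Finset.card_le_card_of_injOn (fun p => insert p.1 p.2.toFinset) (fun p hp => ?_)
    fun p hp p' hp' h => ?_
  · obtain ⟨b, e⟩ := p
    rw [Finset.mem_coe, Finset.mem_product] at hp
    obtain ⟨hb, he⟩ := hp
    induction e using Sym2.ind with
    | _ v w =>
      rw [mem_edgeFinset, mem_edgeSet] at he
      have hadj : ∀ x ∈ G.neighborFinset u, G.Adj b x := fun x hx => by
        by_contra hbx
        have hx' : x ∈ G.missedFinset u b := Finset.mem_filter.mpr ⟨hx, hbx⟩
        rw [(Finset.mem_filter.mp hb).2] at hx'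
        exact Finset.notMem_empty x hx'
      simp only [Sym2.toFinset_mk_eq, Finset.mem_coe]
      have hbu := (mem_farFinset.mp (Finset.mem_filter.mp hb).1).1
      exact mem_trianglesAvoiding.mpr ⟨⟨hadj v he.2.1, hadj w he.2.2, he.1⟩, hbu.symm,
        ((G.mem_neighborFinset _ _).mp he.2.1).ne, ((G.mem_neighborFinset _ _).mp he.2.2).ne⟩
  · rw [Finset.mem_coe, Finset.mem_product] at hp hp'
    obtain ⟨h1, h2⟩ := insert_toFinset_injective (hfar hp.1) (hfar hp'.1)
      (mem_edgeFinset.mp hp.2) (mem_edgeFinset.mp hp'.2) h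
    exact Prod.ext h1 h2

/-- The common neighbours in `N(u)` of two adjacent far vertices give triangles avoiding `u`. -/
theorem degree_le_card_missedFinset_add_of_adj {b b' : V} (hb : b ∈ G.farFinset u)
    (hb' : b' ∈ G.farFinset u) (hadj : G.Adj b b') :
    G.degree u ≤ (G.missedFinset u b).card + (G.missedFinset u b').card +
      (G.trianglesAvoiding u).card := by
  have hcommon : (G.commonFinset u b ∩ G.commonFinset u b').card ≤
      (G.trianglesAvoiding u).card := by
    refine Finset.card_le_card_of_injOn (fun c => {b, b', c}) (fun c hc => ?_)
      fun c hc c' hc' h => ?_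
    · rw [Finset.mem_coe, Finset.mem_inter, commonFinset, commonFinset, Finset.mem_filter,
        Finset.mem_filter, mem_neighborFinset] at hc
      exact mem_trianglesAvoiding.mpr ⟨⟨hadj, hc.1.2, hc.2.2⟩, (mem_farFinset.mp hb).1.symm,
        (mem_farFinset.mp hb').1.symm, hc.1.1.ne⟩
    · rw [Finset.mem_coe, Finset.mem_inter, commonFinset, commonFinset, Finset.mem_filter,
        Finset.mem_filter, mem_neighborFinset] at hc
      have hmem : c ∈ ({b, b', c'} : Finset V) := by
        simp only at h
        rw [← h]
        simp
      simp only [Finset.mem_insert, Finset.mem_singleton] at hmem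
      exact (hmem.resolve_left hc.1.2.ne').resolve_left hc.2.2.ne'
  have hunion := Finset.card_union_add_card_inter (G.commonFinset u b) (G.commonFinset u b')
  have hle : (G.commonFinset u b ∪ G.commonFinset u b').card ≤ G.degree u :=
    Finset.card_le_card
      (Finset.union_subset (Finset.filter_subset _ _) (Finset.filter_subset _ _))
  have h1 := G.card_commonFinset_add_card_missedFinset (u := u) b
  have h2 := G.card_commonFinset_add_card_missedFinset (u := u) b'
  omega

theorem not_exists_unique_triangle_avoiding
    (hindep : ∀ b ∈ G.farFinset u, ∀ b' ∈ G.farFinset u, ¬G.Adj b b')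
    (hmissed : ∀ b ∈ G.farFinset u, (G.missedFinset u b).card = 1)
    (hfar : 2 ≤ (G.farFinset u).card)
    (hedges : 3 ≤ (G.edgesInside (G.neighborFinset u)).edgeFinset.card) :
    (G.trianglesAvoiding u).card ≠ 1 := by
  intro hone
  obtain ⟨T, hT⟩ := Finset.card_eq_one.mp hone
  have hTmem : T ∈ G.trianglesAvoiding u := by rw [hT]; exact Finset.mem_singleton_self T
  have hunique : ∀ {b v w}, b ∈ G.farFinset u → G.Adj u v → G.Adj u w → G.Adj v w → G.Adj b v →
      G.Adj b w → ({b, v, w} : Finset V) = T := fun hb hv hw hvw hbv hbw => by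
    rw [← Finset.mem_singleton, ← hT]
    exact mem_trianglesAvoiding.mpr ⟨⟨hbv, hbw, hvw⟩, (mem_farFinset.mp hb).1.symm, hv.ne, hw.ne⟩
  have hmiss : ∀ b ∈ G.farFinset u, ∃ m, ∀ v, G.Adj u v → (¬G.Adj b v ↔ v = m) := fun b hb => by
    obtain ⟨m, hm⟩ := Finset.card_eq_one.mp (hmissed b hb)
    refine ⟨m, fun v hv => ?_⟩
    rw [← Finset.mem_singleton, ← hm, missedFinset, Finset.mem_filter, mem_neighborFinset]
    exact ⟨fun h => ⟨hv, h⟩, fun h => h.2⟩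
  by_cases hTfar : ∃ b ∈ T, b ∈ G.farFinset u
  · obtain ⟨b, hbT, hb⟩ := hTfar
    obtain ⟨b', hb', hbb'⟩ := Finset.exists_mem_ne (s := G.farFinset u) (by omega) b
    have hTclique := (mem_cliqueFinset_iff.mp (Finset.mem_filter.mp hTmem).1).isClique
    obtain ⟨c, hc⟩ := hmiss b' hb'
    have hstar : ∀ {v w}, G.Adj u v → G.Adj u w → G.Adj v w → v = c ∨ w = c := by
      intro v w hv hw hvw
      by_contra! hne
      have h := hunique hb' hv hw hvw (not_not.mp fun h => hne.1 ((hc v hv).mp h))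
        (not_not.mp fun h => hne.2 ((hc w hw).mp h))
      have hb'T : b' ∈ T := by rw [← h]; simp
      exact hindep b hb b' hb' (hTclique hbT hb'T hbb'.symm)
    set leaves := (G.neighborFinset u).filter fun w => G.Adj c w with hleaves
    have hcard : 3 ≤ leaves.card := by
      refine hedges.trans ((Finset.card_le_card fun e he => ?_).trans
        (Finset.card_image_le (s := leaves) (f := fun w => s(c, w))))
      induction e using Sym2.ind with
      | _ v w =>
        rw [mem_edgeFinset, mem_edgeSet] at he
        obtain ⟨hvw, hv, hw⟩ := he
        rw [Finset.mem_image]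
        rcases hstar ((G.mem_neighborFinset _ _).mp hv) ((G.mem_neighborFinset _ _).mp hw) hvw
          with rfl | rfl
        · exact ⟨w, Finset.mem_filter.mpr ⟨hw, hvw⟩, rfl⟩
        · exact ⟨v, Finset.mem_filter.mpr ⟨hv, hvw.symm⟩, Sym2.eq_swap⟩
    obtain ⟨p, q, r, hpqr⟩ : ∃ p q r, G.Adj p q ∧ G.Adj p r ∧ G.Adj q r ∧ T = {p, q, r} :=
      is3Clique_iff.mp (mem_cliqueFinset_iff.mp (Finset.mem_filter.mp hTmem).1)
    have huT : u ∉ T := (Finset.mem_filter.mp hTmem).2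
    have hnbr : ∀ v ∈ T, v ≠ b → G.Adj u v ∧ G.Adj b v := fun v hv hvb => by
      have hbv := hTclique hbT hv hvb.symm
      refine ⟨?_, hbv⟩
      by_contra huv
      exact hindep b hb v (mem_farFinset.mpr ⟨fun h => huT (h ▸ hv), huv⟩) hbv
    obtain ⟨v, w, hvT, hwT, hvb, hwb, hvw⟩ :
        ∃ v w, v ∈ T ∧ w ∈ T ∧ v ≠ b ∧ w ≠ b ∧ G.Adj v w := by
      obtain ⟨hpq, hpr, hqr, rfl⟩ := hpqr
      simp only [Finset.mem_insert, Finset.mem_singleton] at hbT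
      rcases hbT with rfl | rfl | rfl
      · exact ⟨q, r, by simp, by simp, hpq.ne', hpr.ne', hqr⟩
      · exact ⟨p, r, by simp, by simp, hpq.ne, hqr.ne', hpr⟩
      · exact ⟨p, q, by simp, by simp, hpr.ne, hqr.ne, hpq⟩
    have hbc : G.Adj u c ∧ G.Adj b c := by
      rcases hstar (hnbr v hvT hvb).1 (hnbr w hwT hwb).1 hvw with rfl | rfl
      exacts [hnbr _ hvT hvb, hnbr _ hwT hwb]
    obtain ⟨m, hm⟩ := hmiss b hb
    have hleaf : ∀ x ∈ leaves.erase m, x ∈ (T.erase b).erase c := fun x hx => by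
      rw [Finset.mem_erase, hleaves, Finset.mem_filter, mem_neighborFinset] at hx
      obtain ⟨hxm, hux, hcx⟩ := hx
      have hbx : G.Adj b x := not_not.mp fun h => hxm ((hm x hux).mp h)
      have h := hunique hb hbc.1 hux hcx hbc.2 hbx
      rw [Finset.mem_erase, Finset.mem_erase, ← h]
      exact ⟨hcx.ne', hbx.ne', by simp⟩
    have hcT : c ∈ T := by
      have h2 : 0 < (leaves.erase m).card := by
        have := Finset.pred_card_le_card_erase (s := leaves) (a := m)
        omega
      obtain ⟨x, hx⟩ := Finset.card_pos.mp h2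
      rw [Finset.mem_erase, hleaves, Finset.mem_filter, mem_neighborFinset] at hx
      obtain ⟨hxm, hux, hcx⟩ := hx
      rw [← hunique hb hbc.1 hux hcx hbc.2 (not_not.mp fun h => hxm ((hm x hux).mp h))]
      simp
    have hcard2 := Finset.card_le_card hleaf
    have hTcard : T.card = 3 :=
      (mem_cliqueFinset_iff.mp (Finset.mem_filter.mp hTmem).1).card_eq
    rw [Finset.card_erase_of_mem (Finset.mem_erase.mpr ⟨hbc.2.ne', hcT⟩),
      Finset.card_erase_of_mem hbT, hTcard] at hcard2
    have := Finset.pred_card_le_card_erase (s := leaves) (a := m)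
    omega
  · push Not at hTfar
    obtain ⟨b, hb⟩ := Finset.card_pos.mp (show 0 < (G.farFinset u).card by omega)
    obtain ⟨m, hm⟩ := hmiss b hb
    obtain ⟨p, q, r, hpq, hpr, hqr, rfl⟩ :=
      is3Clique_iff.mp (mem_cliqueFinset_iff.mp (Finset.mem_filter.mp hTmem).1)
    have hu : u ∉ ({p, q, r} : Finset V) := (Finset.mem_filter.mp hTmem).2
    have hadj : ∀ v ∈ ({p, q, r} : Finset V), G.Adj u v := fun v hv => by
      by_contra huv
      exact hTfar v hv (mem_farFinset.mpr ⟨fun h => hu (h ▸ hv), huv⟩)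
    have hp := hadj p (by simp)
    have hq := hadj q (by simp)
    have hr := hadj r (by simp)
    have hpair : ∀ {v w}, G.Adj u v → G.Adj u w → G.Adj v w → v = m ∨ w = m := by
      intro v w hv hw hvw
      by_contra! hne
      have h := hunique hb hv hw hvw (not_not.mp fun h => hne.1 ((hm v hv).mp h))
        (not_not.mp fun h => hne.2 ((hm w hw).mp h))
      exact hTfar b (by rw [← h]; simp) hb
    have h1 := hpair hp hq hpq
    have h2 := hpair hp hr hpr
    have h3 := hpair hq hr hqr
    have := hpq.ne
    have := hpr.ne
    have := hqr.ne
    grind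

/-- The far vertices adjacent to all of `N(u)` do not exist, by counting. -/
theorem card_full_eq_zero_arith {k l a β E τ X M f : ℕ} (hkl : l = k ∨ l = k + 1)
    (hcard : k + l = 1 + a + β) (ht : E + τ ≤ k) (hdeg : k < a) (hS : k * l + 2 < a + 2 * E + X)
    (hXM : X + M = β * a) (hf : f * E ≤ τ) (hfβ : β ≤ f + M) : f = 0 := by
  by_contra hf0
  obtain ⟨g, rfl⟩ : ∃ g, f = g + 1 := ⟨f - 1, by omega⟩
  obtain ⟨j, rfl⟩ : ∃ j, a = k + 1 + j := ⟨a - (k + 1), by omega⟩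
  obtain rfl : l = β + j + 2 := by omega
  obtain rfl | ⟨F, rfl⟩ : E = 0 ∨ ∃ F, E = F + 1 := by
    cases E
    exacts [Or.inl rfl, Or.inr ⟨_, rfl⟩]
  · rcases hkl with h | h
    · subst h
      nlinarith
    · obtain rfl : k = β + j + 1 := by omega
      nlinarith
  · rcases hkl with h | h
    · subst h
      nlinarith [Nat.zero_le (g * F), Nat.le_self_pow two_ne_zero j]
    · obtain rfl : k = β + j + 1 := by omega
      nlinarith [Nat.zero_le (g * F), Nat.le_self_pow two_ne_zero j]

/-- Two adjacent far vertices miss too many neighbours of `u`, by counting. -/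
theorem farFinset_indep_arith {k l a β E X M τ : ℕ} (hkl : l = k ∨ l = k + 1)
    (hcard : k + l = 1 + a + β) (ht : E + τ ≤ k) (hdeg : k < a) (hS : k * l + 2 < a + 2 * E + X)
    (hXM : X + M = β * a) (hM : a + β ≤ M + τ + 2) : False := by
  obtain ⟨j, rfl⟩ : ∃ j, a = k + 1 + j := ⟨a - (k + 1), by omega⟩
  obtain rfl : l = β + j + 2 := by omega
  rcases hkl with h | h
  · subst h
    nlinarith
  · obtain rfl : k = β + j + 1 := by omega
    nlinarith

/-- Equality holds throughout the counting when some triangle avoids `u`. -/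
theorem extremal_arith {k l a β E X M τ m : ℕ} (hkl : l = k ∨ l = k + 1)
    (hcard : k + l = 1 + a + β) (ht : E + τ ≤ k) (hdeg : k < a) (hS : k * l + 2 < a + 2 * E + X)
    (hXM : X + M = β * a) (hM : β ≤ M) (hm : k * l ≤ m)
    (hedge : 2 * m = a + (a + 2 * E + X) + X) (hτ : τ ≠ 0) :
    τ = 1 ∧ M = β ∧ 2 ≤ β ∧ 3 ≤ E := by
  obtain ⟨j, rfl⟩ : ∃ j, a = k + 1 + j := ⟨a - (k + 1), by omega⟩
  obtain rfl : l = β + j + 2 := by omega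
  have hτ1 : 1 ≤ τ := by omega
  rcases hkl with h | h
  · subst h
    have hj : j = 0 := by
      by_contra hj
      nlinarith [Nat.pos_of_ne_zero hj]
    subst hj
    have h1 : M + 1 ≤ E := by nlinarith
    have h2 : M + 3 < 2 * E := by nlinarith
    omega
  · obtain rfl : k = β + j + 1 := by omega
    have h1 : M + j * j + j ≤ E := by nlinarith
    have h2 : M + j * j + j + 2 < 2 * E := by nlinarith
    have hj : j = 0 := by nlinarith
    subst hj
    omega

/-- A graph with few triangles, at least as many edges as the balanced complete bipartite graph
and large degree sum over `N(u)` has all its triangles through `u`. -/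
theorem trianglesAvoiding_eq_empty {k l : ℕ} (hkl : l = k ∨ l = k + 1)
    (hcard : Fintype.card V = k + l) (ht : (G.cliqueFinset 3).card ≤ k) (hdeg : k < G.degree u)
    (hS : k * l + 2 < ∑ v ∈ G.neighborFinset u, G.degree v) (hm : k * l ≤ G.edgeFinset.card) :
    G.trianglesAvoiding u = ∅ := by
  rw [← card_edgesInside_add_card_trianglesAvoiding u] at ht
  rw [card_eq_degree_add_card_farFinset (G := G) (u := u)] at hcard
  have hsum := sum_degree_neighborFinset (G := G) (u := u)
  have hXM : ∑ b ∈ G.farFinset u, (G.commonFinset u b).card +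
      ∑ b ∈ G.farFinset u, (G.missedFinset u b).card =
        (G.farFinset u).card * G.degree u := by
    rw [← Finset.sum_add_distrib, Finset.sum_congr rfl fun b _ =>
      card_commonFinset_add_card_missedFinset (G := G) b, Finset.sum_const, smul_eq_mul]
  have hfull : ∀ b ∈ G.farFinset u, 1 ≤ (G.missedFinset u b).card := by
    have hf := card_full_eq_zero_arith hkl hcard.symm ht hdeg (hsum ▸ hS) hXM
      card_full_mul_card_le_card_trianglesAvoiding (by
        rw [Finset.card_filter, ← Finset.sum_add_distrib, Finset.card_eq_sum_ones]
        refine Finset.sum_le_sum fun b _ => ?_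
        split_ifs with h
        · omega
        · have := Finset.card_pos.mpr (Finset.nonempty_iff_ne_empty.mpr h)
          omega)
    intro b hb
    rw [Finset.card_eq_zero, Finset.filter_eq_empty_iff] at hf
    exact Finset.card_pos.mpr (Finset.nonempty_iff_ne_empty.mpr (hf hb))
  have hindep : ∀ b ∈ G.farFinset u, ∀ b' ∈ G.farFinset u, ¬G.Adj b b' := by
    intro b hb b' hb' hadj
    refine farFinset_indep_arith hkl hcard.symm ht hdeg (hsum ▸ hS) hXM ?_
    have hb'2 : b' ∈ (G.farFinset u).erase b := Finset.mem_erase.mpr ⟨hadj.ne', hb'⟩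
    have hdegle := degree_le_card_missedFinset_add_of_adj hb hb' hadj
    rw [← Finset.add_sum_erase _ _ hb, ← Finset.add_sum_erase _ _ hb'2]
    have hrest := Finset.card_nsmul_le_sum (((G.farFinset u).erase b).erase b')
      (fun v => (G.missedFinset u v).card) 1
      fun v hv => hfull v (Finset.mem_of_mem_erase (Finset.mem_of_mem_erase hv))
    rw [Finset.card_erase_of_mem hb'2, Finset.card_erase_of_mem hb, smul_eq_mul, mul_one] at hrest
    omega
  have hM : (G.farFinset u).card ≤ ∑ b ∈ G.farFinset u, (G.missedFinset u b).card := by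
    simpa using Finset.card_nsmul_le_sum (G.farFinset u) _ 1 hfull
  have hedge := two_mul_card_edgeFinset_of_farFinset_indep hindep
  rw [hsum] at hedge
  by_contra hne
  obtain ⟨hτ, hMβ, hβ, hE⟩ := extremal_arith hkl hcard.symm ht hdeg (hsum ▸ hS) hXM hM hm hedge
    fun h => hne (Finset.card_eq_zero.mp h)
  refine not_exists_unique_triangle_avoiding hindep (fun b hb => ?_) hβ hE hτ
  rw [Finset.card_eq_sum_ones] at hMβ
  exact ((Finset.sum_eq_sum_iff_of_le hfull).mp hMβ.symm b hb).symm

end SimpleGraph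

end Combinatorics

theorem triangleCount_eq_card_cliqueFinset {V : Type*} [Fintype V] [DecidableEq V]
    (G : SimpleGraph V) [DecidableRel G.Adj] : triangleCount G = (G.cliqueFinset 3).card := by
  unfold triangleCount
  congr!

/-- If no triangle avoids `u`, the triangles correspond to the edges inside `N(u)`. -/
theorem triangleCount_eq_ncard_of_trianglesAvoiding_eq_empty {V : Type*} [Fintype V]
    [DecidableEq V] (G : SimpleGraph V) [DecidableRel G.Adj] {u : V}
    (h : G.trianglesAvoiding u = ∅) :
    triangleCount G = {e ∈ G.edgeSet | ∀ w ∈ e, G.Adj u w}.ncard := by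
  have hset : {e ∈ G.edgeSet | ∀ w ∈ e, G.Adj u w} =
      ((G.edgesInside (G.neighborFinset u)).edgeFinset : Set (Sym2 V)) := by
    ext e
    induction e using Sym2.ind with
    | _ a b =>
      rw [Finset.mem_coe, SimpleGraph.mem_edgeFinset, SimpleGraph.mem_edgeSet]
      simp [SimpleGraph.edgesInside]
  rw [triangleCount_eq_card_cliqueFinset,
    ← SimpleGraph.card_edgesInside_add_card_trianglesAvoiding u, h, hset, Set.ncard_coe_finset,
    Finset.card_empty, add_zero]

/-- A graph on at least four vertices with few triangles and spectral radius at least that of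
`K⁺` has all its triangles through a vertex of maximal Perron weight. -/
theorem trianglesAvoiding_eq_empty_of_specRad {n : ℕ} (hn : 4 ≤ n) (G : SimpleGraph (Fin n))
    [DecidableRel G.Adj] (ht : triangleCount G ≤ n / 2) (hspec : specRad (Kplus n) ≤ specRad G)
    {x : Fin n → ℝ} (hx : ∀ v, 0 < x v) (hunit : ∑ v, x v ^ 2 = 1)
    (heig : G.adjMatrix ℝ *ᵥ x = specRad G • x) {u : Fin n} (hu : ∀ v, x v ≤ x u) :
    G.trianglesAvoiding u = ∅ := by
  rw [triangleCount_eq_card_cliqueFinset] at ht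
  obtain ⟨hpos, hlower⟩ := div_four_add_two_lt_specRad_Kplus_sq hn
  have hkl : (n + 1) / 2 = n / 2 ∨ (n + 1) / 2 = n / 2 + 1 := by omega
  have hcard : Fintype.card (Fin n) = n / 2 + (n + 1) / 2 := by
    rw [Fintype.card_fin]
    omega
  generalize n / 2 = k at *
  generalize (n + 1) / 2 = l at *
  set lam := specRad G
  have hlam : (k * l : ℝ) + 2 < lam ^ 2 := hlower.trans_le (pow_le_pow_left₀ hpos hspec 2)
  have hkl' : (k : ℝ) ≤ l := by exact_mod_cast (by omega : k ≤ l)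
  have hk0 : (0 : ℝ) ≤ k := k.cast_nonneg
  have hlam0 : 0 ≤ lam := hpos.trans hspec
  have hklam : (k : ℝ) < lam := lt_of_pow_lt_pow_left₀ 2 hlam0 (by nlinarith)
  refine SimpleGraph.trianglesAvoiding_eq_empty hkl hcard ht ?_ ?_ ?_
  · exact_mod_cast hklam.trans_le (G.eigenvalue_le_degree heig (hx u) hu)
  · exact_mod_cast hlam.trans_le (G.eigenvalue_sq_le_sum_degree heig (hx u) hu)
  · have hcube := G.spectral_triangle_bound hx hunit heig
    have ht' : ((G.cliqueFinset 3).card : ℝ) ≤ k := by exact_mod_cast ht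
    have hsq : lam ^ 2 < G.edgeFinset.card + 3 := by
      have hlampos : 0 < lam := hk0.trans_lt hklam
      refine lt_of_mul_lt_mul_left ?_ hlampos.le
      nlinarith
    have hlt : k * l + 2 < G.edgeFinset.card + 3 := by exact_mod_cast hlam.trans hsq
    omega

/-- In the Setup, every triangle of `G` contains `u*`; equivalently, `t(G)` equals the
number of edges of the induced subgraph `G[A]` with `A = N(u*)`. -/
theorem setup_all_triangles_through_ustar
    (n : ℕ) (hn : 3 ≤ n) (G : SimpleGraph (Fin n)) [DecidableRel G.Adj]
    (ht : triangleCount G ≤ n / 2)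
    (hspec : specRad (Kplus n) ≤ specRad G)
    (hmaxspec : ∀ H : SimpleGraph (Fin n), triangleCount H ≤ n / 2 → specRad H ≤ specRad G)
    (hconn : G.Connected)
    (x : Fin n → ℝ) (hxpos : ∀ v, 0 < x v) (hxunit : ∑ v, x v ^ 2 = 1)
    (heig : SimpleGraph.adjMatrix ℝ G *ᵥ x = specRad G • x)
    (ustar : Fin n) (hustar : ∀ v, x v ≤ x ustar)
    :
    (∀ T ∈ G.cliqueFinset 3, ustar ∈ T) ∧
      triangleCount G = {e ∈ G.edgeSet | ∀ w ∈ e, G.Adj ustar w}.ncard := by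
  have havoid : G.trianglesAvoiding ustar = ∅ := by
    rcases Nat.lt_or_ge n 4 with hn4 | hn4
    · refine Finset.filter_eq_empty_iff.mpr fun T hT => not_not.mpr ?_
      have hT3 := (G.mem_cliqueFinset_iff.mp hT).card_eq
      rw [(Finset.card_eq_iff_eq_univ T).mp (by rw [hT3, Fintype.card_fin]; omega)]
      exact Finset.mem_univ ustar
    · exact trianglesAvoiding_eq_empty_of_specRad hn4 G ht hspec hxpos hxunit heig hustar
  exact ⟨fun T hT => not_not.mp (Finset.filter_eq_empty_iff.mp havoid hT),
    triangleCount_eq_ncard_of_trianglesAvoiding_eq_empty G havoid⟩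
end
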